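/- arXiv:1305.6886 — 16 statements merged into one kernel-verified Lean document; each statement's English description precedes it below -/
import Mathlib

section
/- In a unitary AG-groupoid S, every (∈,∈∨q_k)-fuzzy right ideal of S is an (∈,∈∨q_k)-fuzzy left ideal of S: if f is a fuzzy subset of S with f(x·y) ≥ min(f(x), (1-k)/2) for all x, y in S, then f(x·y) ≥ min(f(y), (1-k)/2) for all x, y in S. -/
/-- In a unitary AG-groupoid `S`, every `(∈,∈∨q_k)`-fuzzy right ideal of `S`
is an `(∈,∈∨q_k)`-fuzzy left ideal of `S`: if `f` is a fuzzy subset of `S`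
with `f (x·y) ≥ min (f x) ((1-k)/2)` for all `x y`, then
`f (x·y) ≥ min (f y) ((1-k)/2)` for all `x y`. -/
theorem fuzzy_right_ideal_is_left_ideal {S : Type*} (m : S → S → S)
    (hinv : ∀ a b c : S, m (m a b) c = m (m c b) a)
    (e : S) (he : ∀ a : S, m e a = a)
    (k : ℝ) (hk0 : 0 ≤ k) (hk1 : k < 1)
    (f : S → ℝ) (hf0 : ∀ x, 0 ≤ f x) (hf1 : ∀ x, f x ≤ 1)
    (hright : ∀ x y : S, f (m x y) ≥ min (f x) ((1 - k) / 2)) :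
    ∀ x y : S, f (m x y) ≥ min (f y) ((1 - k) / 2) := by
  intro x y
  have h : m x y = m (m y x) e := by
    rw [← hinv e x y, he]
  rw [h]
  exact le_trans (le_min (hright y x) (min_le_right _ _)) (hright (m y x) e)
end

section
/- In a unitary intra-regular AG-groupoid S, for every a in S there exists z in S such that a = a·(z·a). -/
/-- In a unitary intra-regular AG-groupoid `S`, for every `a` there exists
`z` with `a = a·(z·a)`. -/
theorem intra_regular_az {S : Type*} (m : S → S → S)
    (hinv : ∀ a b c : S, m (m a b) c = m (m c b) a)
    (e : S) (he : ∀ a : S, m e a = a)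
    (hintra : ∀ a : S, ∃ x y : S, a = m (m x (m a a)) y) :
    ∀ a : S, ∃ z : S, a = m a (m z a) := by
  have lp : ∀ a b c : S, m a (m b c) = m b (m a c) := fun a b c =>
    calc m a (m b c) = m (m e a) (m b c) := by rw [he]
      _ = m (m (m b c) a) e := hinv _ _ _
      _ = m (m (m a c) b) e := by rw [hinv b c a]
      _ = m (m e b) (m a c) := hinv _ _ _
      _ = m b (m a c) := by rw [he]
  intro a
  obtain ⟨x, y, h⟩ := hintra a
  refine ⟨m y (m x e), h.trans ?_⟩
  rw [lp a, hinv y, lp (m a a) x e, hinv a a e, he]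
end

section
/- In a unitary intra-regular AG-groupoid S, for every a in S there exists w in S such that a = (w·a)·a. -/
/-- In a unitary intra-regular AG-groupoid `S`, for every `a` there exists
`w` with `a = (w·a)·a`. -/
theorem intra_regular_wa {S : Type*} (m : S → S → S)
    (hinv : ∀ a b c : S, m (m a b) c = m (m c b) a)
    (e : S) (he : ∀ a : S, m e a = a)
    (hintra : ∀ a : S, ∃ x y : S, a = m (m x (m a a)) y) :
    ∀ a : S, ∃ w : S, a = m (m w a) a := by
  have med : ∀ a b c d : S, m (m a b) (m c d) = m (m a c) (m b d) := by
    intro a b c d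
    rw [hinv a b (m c d), hinv c d b, hinv (m b d) c a]
  have lc : ∀ a b c : S, m a (m b c) = m b (m a c) := by
    intro a b c
    have h := med e a b c
    rwa [he, he] at h
  intro a
  obtain ⟨x, y, h⟩ := hintra a
  refine ⟨m (m y e) x, ?_⟩
  have h1 : m x (m a a) = m (m (m a a) x) e := by
    rw [hinv (m a a) x e, he]
  rw [h1, hinv (m (m a a) x) e y, lc, hinv a a] at h
  rw [hinv] at h ⊢
  exact h
end

section
/- In a unitary intra-regular AG-groupoid S, for every a in S there exist x, y in S such that a = ((a·a)·((x·x)·(y·y)))·a, and consequently also a = (a·((x·x)·(y·y)))·(a·a). -/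
theorem aux_comm {S : Type*} [CommMonoid S] (f : S → S)
    (ff : ∀ a, f (f a) = a) (fm : ∀ a b, f (a * b) = f a * f b) (a x y : S)
    (h : a = x * y * (a * f a)) : a = (a * a * f a) * (x * f x * (y * f y)) := by
  have h2 : f a = f x * f y * (f a * a) := by
    have := congrArg f h
    simpa only [fm, ff] using this
  calc a = x * y * (a * f a) := h
    _ = x * y * (a * (f x * f y * (f a * a))) := by rw [← h2]
    _ = _ := by ac_rfl

/-- In a unitary intra-regular AG-groupoid `S`, for every `a` there exist
`x, y` with `a = ((a·a)·((x·x)·(y·y)))·a` and also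
`a = (a·((x·x)·(y·y)))·(a·a)`. -/
theorem intra_regular_squares {S : Type*} (m : S → S → S)
    (hinv : ∀ a b c : S, m (m a b) c = m (m c b) a)
    (e : S) (he : ∀ a : S, m e a = a)
    (hintra : ∀ a : S, ∃ x y : S, a = m (m x (m a a)) y) :
    ∀ a : S, ∃ x y : S,
      a = m (m (m a a) (m (m x x) (m y y))) a ∧
      a = m (m a (m (m x x) (m y y))) (m a a) := by
  have ff : ∀ a, m (m a e) e = a := fun a => by rw [hinv, he, he]
  have med : ∀ a b c d, m (m a b) (m c d) = m (m a c) (m b d) := fun a b c d => by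
    rw [hinv a b, hinv c d b, hinv (m b d) c a]
  have fm : ∀ a b, m (m a b) e = m (m a e) (m b e) := fun a b => by
    rw [← med, he e]
  have comm : ∀ a b, m (m a e) b = m (m b e) a := fun a b => hinv a e b
  have assoc : ∀ a b c, m (m (m (m a e) b) e) c = m (m a e) (m (m b e) c) := fun a b c => by
    rw [fm, ff, hinv a (m b e) c, comm a, fm, hinv (m b e) e (m c e), ff]
  letI : CommMonoid S :=
    { mul := fun a b => m (m a e) b
      one := e
      mul_assoc := assoc
      mul_comm := comm
      one_mul := fun a => by change m (m e e) a = a; rw [he, he]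
      mul_one := ff }
  have hm : ∀ a b : S, m a b = m a e * b := fun a b => by
    change m a b = m (m (m a e) e) b
    rw [ff]
  obtain ⟨f, hf⟩ : ∃ f : S → S, f = fun a => m a e := ⟨_, rfl⟩
  have hm' : ∀ a b : S, m a b = f a * b := fun a b => by rw [hf]; exact hm a b
  have ff' : ∀ a, f (f a) = a := fun a => by rw [hf]; exact ff a
  have fm' : ∀ a b, f (a * b) = f a * f b := fun a b => by
    rw [hf]
    exact fm (m a e) b
  intro a
  obtain ⟨x, y, h⟩ := hintra a
  refine ⟨x, y, ?_⟩
  simp only [hm', fm', ff'] at h ⊢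
  have key := aux_comm f ff' fm' a x y (h.trans (by ac_rfl))
  exact ⟨key.trans (by ac_rfl), key.trans (by ac_rfl)⟩
end

section
/- In a unitary intra-regular AG-groupoid S, for every a in S there exists z in S such that a = ((a·a)·z)·(a·a), and there exists z' in S such that a·a = (a·z')·a. -/
theorem intra_aux {S : Type*} [CommSemigroup S] (f : S → S) (ff : ∀ a, f (f a) = a)
    (fm : ∀ a b, f (a * b) = f a * f b)
    (a x y : S) (h : a = f (f x * (f a * a)) * y) :
    (∃ z : S, a = f (f (f a * a) * z) * (f a * a)) ∧ (∃ z : S, f a * a = f (f a * z) * a) := by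
  simp only [fm, ff] at h ⊢
  obtain ⟨u, hu⟩ : ∃ u, u = x * y := ⟨_, rfl⟩
  have h1 : a = a * f a * u := by rw [hu]; exact h.trans (by ac_rfl)
  have h2 : f a = f a * a * f u := by
    have := congrArg f h1
    simpa only [fm, ff] using this
  have h3 : a * f a = (a * f a * u) * (f a * a * f u) := by rw [← h1, ← h2]
  refine ⟨⟨f (u * u * f u), ?_⟩, ⟨f (f a * f u), ?_⟩⟩
  · rw [ff]
    calc a = a * f a * u := h1
      _ = (a * f a * u) * (f a * a * f u) * u := by rw [← h3]
      _ = _ := by ac_rfl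
  · rw [ff]
    calc f a * a = (f a * a * f u) * a := by rw [← h2]
      _ = _ := by ac_rfl

/-- In a unitary intra-regular AG-groupoid `S`, for every `a` there exists
`z` with `a = ((a·a)·z)·(a·a)` and there exists `z'` with `a·a = (a·z')·a`. -/
theorem intra_regular_a2z {S : Type*} (m : S → S → S)
    (hinv : ∀ a b c : S, m (m a b) c = m (m c b) a)
    (e : S) (he : ∀ a : S, m e a = a)
    (hintra : ∀ a : S, ∃ x y : S, a = m (m x (m a a)) y) :
    ∀ a : S, (∃ z : S, a = m (m (m a a) z) (m a a)) ∧
      (∃ z' : S, m a a = m (m a z') a) := by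
  intro a
  have ff : ∀ a, m (m a e) e = a := fun a => by rw [hinv, he, he]
  have comm : ∀ a b, m (m a e) b = m (m b e) a := fun a b => hinv _ _ _
  have fp : ∀ a b, m (m (m a e) b) e = m b (m a e) := fun a b => by
    rw [hinv (m a e) b e, he]
  have key : ∀ a b c, m (m (m (m a e) b) e) c = m (m (m (m a e) c) e) b := fun a b c => by
    rw [fp, fp, hinv]
  letI : CommSemigroup S :=
    { mul := fun a b => m (m a e) b
      mul_comm := comm
      mul_assoc := fun a b c => by
        change m (m (m (m a e) b) e) c = m (m a e) (m (m b e) c)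
        rw [comm a b, key b a c, comm a] }
  have hm : ∀ a b : S, m a b = m a e * b := fun a b => by
    change _ = m (m (m a e) e) b
    rw [ff]
  obtain ⟨x, y, h⟩ := hintra a
  have := intra_aux (fun a => m a e) ff (fun a b => by
    change m (m (m a e) b) e = m (m (m a e) e) (m b e)
    rw [comm a b, fp, ff]) a x y (by
      change a = m (m (m (m (m (m x e) e) (m (m (m a e) e) a)) e) e) y
      simp only [ff]; exact h)
  change (∃ z : S, a = m (m (m (m (m (m (m (m (m a e) e) a) e) e) z) e) e) (m (m (m a e) e) a)) ∧
    (∃ z : S, m (m (m a e) e) a = m (m (m (m (m (m a e) e) z) e) e) a) at this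
  simpa only [ff] using this
end

section
/- In a unitary intra-regular AG-groupoid S, every left ideal, every right ideal, every generalized bi-ideal, and every generalized interior ideal of S is semiprime. -/
/-- In a unitary intra-regular AG-groupoid `S`, every left ideal, every right
ideal, every generalized bi-ideal, and every generalized interior ideal is
semiprime (`a·a ∈ A → a ∈ A`). -/
theorem ideals_semiprime {S : Type*} (m : S → S → S)
    (hinv : ∀ a b c : S, m (m a b) c = m (m c b) a)
    (e : S) (he : ∀ a : S, m e a = a)
    (hintra : ∀ a : S, ∃ x y : S, a = m (m x (m a a)) y) :
    (∀ A : Set S, A.Nonempty → Set.image2 m Set.univ A ⊆ A →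
        ∀ a : S, m a a ∈ A → a ∈ A) ∧
    (∀ A : Set S, A.Nonempty → Set.image2 m A Set.univ ⊆ A →
        ∀ a : S, m a a ∈ A → a ∈ A) ∧
    (∀ A : Set S, A.Nonempty → Set.image2 m (Set.image2 m A Set.univ) A ⊆ A →
        ∀ a : S, m a a ∈ A → a ∈ A) ∧
    (∀ A : Set S, A.Nonempty → Set.image2 m (Set.image2 m Set.univ A) Set.univ ⊆ A →
        ∀ a : S, m a a ∈ A → a ∈ A) := by
  have med : ∀ a b c d, m (m a b) (m c d) = m (m a c) (m b d) := by
    intro a b c d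
    rw [hinv a b (m c d), hinv c d b, hinv (m b d) c a]
  have lc : ∀ a b c, m a (m b c) = m b (m a c) := by
    intro a b c
    have h := med e a b c
    rw [he, he] at h
    exact h
  have par : ∀ a b c d, m (m a b) (m c d) = m (m d c) (m b a) := by
    intro a b c d
    -- swap outer factors: (u)(v) with u = e u
    have h1 : m (m a b) (m c d) = m (m (m c d) b) a := hinv _ _ _
    have h2 : m (m c d) b = m (m b d) c := hinv _ _ _
    have h3 : m (m d c) (m b a) = m b (m (m d c) a) := lc _ _ _
    have h4 : m (m d c) a = m (m a c) d := hinv _ _ _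
    have h5 : m b (m (m a c) d) = m (m a c) (m b d) := lc _ _ _
    rw [h3, h4, h5, med]
  have key : ∀ a, ∃ t, a = m (m a a) t := by
    intro a
    obtain ⟨x, y, h⟩ := hintra a
    refine ⟨m (m y e) x, ?_⟩
    have h1 : m (m x (m a a)) (m e y) = m (m y e) (m (m a a) x) := par _ _ _ _
    rw [he, ← h, lc] at h1
    exact h1
  -- squares commute past everything up to twisting
  have sq : ∀ s t, m (m s s) t = m (m t e) (m s s) := by
    intro s t
    have h := par s s e t
    rw [he] at h
    exact h
  have sq' : ∀ s q, m q (m s s) = m (m s s) (m q e) := by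
    intro s q
    have h := par e q s s
    rw [he] at h
    exact h
  refine ⟨?_, ?_, ?_, ?_⟩
  · intro A _ hA a ha
    obtain ⟨t, h⟩ := key a
    rw [h, sq]
    exact hA (Set.mem_image2_of_mem (Set.mem_univ _) ha)
  · intro A _ hA a ha
    obtain ⟨t, h⟩ := key a
    rw [h]
    exact hA (Set.mem_image2_of_mem ha (Set.mem_univ _))
  · intro A _ hA a ha
    obtain ⟨t, h⟩ := key a
    have h2 : m a a = m (m (m a a) (m a a)) (m t t) := by
      have h3 := med (m a a) t (m a a) t
      rw [← h] at h3
      exact h3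
    have h4 : ∃ p, a = m (m (m a a) p) (m a a) := by
      refine ⟨m (m (m t (m t t)) e) e, ?_⟩
      rw [← sq', hinv, ← sq', ← hinv, ← h2, ← h]
    obtain ⟨p, h4⟩ := h4
    rw [h4]
    exact hA (Set.mem_image2_of_mem (Set.mem_image2_of_mem ha (Set.mem_univ _)) ha)
  · intro A _ hA a ha
    obtain ⟨x, y, h⟩ := hintra a
    rw [h]
    exact hA (Set.mem_image2_of_mem (Set.mem_image2_of_mem (Set.mem_univ _) ha) (Set.mem_univ _))
end

section
/- A unitary AG-groupoid S is intra-regular if and only if for every a in S there exists s in S with a = s·(a·a) (i.e., a ∈ Sa² for every a ∈ S). -/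
/-- A unitary AG-groupoid `S` is intra-regular if and only if `a ∈ Sa²` for
every `a ∈ S`, i.e. for every `a` there is `s` with `a = s·(a·a)`. -/
theorem intra_regular_iff_mem_Sa2 {S : Type*} (m : S → S → S)
    (hinv : ∀ a b c : S, m (m a b) c = m (m c b) a)
    (e : S) (he : ∀ a : S, m e a = a) :
    (∀ a : S, ∃ x y : S, a = m (m x (m a a)) y) ↔
    (∀ a : S, ∃ s : S, a = m s (m a a)) := by
  have med : ∀ a b c d : S, m (m a b) (m c d) = m (m a c) (m b d) := by
    intro a b c d
    rw [hinv a b (m c d), hinv c d b, hinv (m b d) c a]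
  have lc : ∀ a b c : S, m a (m b c) = m b (m a c) := by
    intro a b c
    have h := med e a b c
    rwa [he, he] at h
  have rev : ∀ a b c d : S, m (m a b) (m c d) = m (m d c) (m b a) := by
    intro a b c d
    rw [lc (m a b) c d, hinv a b d, lc c (m d b) a, med d b c a]
  have sw : ∀ a t : S, m (m a a) t = m (m t e) (m a a) := by
    intro a t
    have h := rev a a e t
    rwa [he] at h
  constructor
  · intro h a
    obtain ⟨x, y, hxy⟩ := h a
    refine ⟨m (m (m x e) y) e, ?_⟩
    rw [← sw, lc (m a a) (m x e) y, ← med, he]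
    exact hxy
  · intro h a
    obtain ⟨s, hs⟩ := h a
    refine ⟨e, m s e, ?_⟩
    have h2 := rev e s a a
    rw [he] at h2
    rw [he, ← h2]
    exact hs
end

section
/- A unitary AG-groupoid S is intra-regular if and only if all its right ideals are semiprime. -/
/-- A unitary AG-groupoid `S` is intra-regular if and only if all its right
ideals are semiprime. -/
theorem intra_regular_iff_right_ideals_semiprime {S : Type*} (m : S → S → S)
    (hinv : ∀ a b c : S, m (m a b) c = m (m c b) a)
    (e : S) (he : ∀ a : S, m e a = a) :
    (∀ a : S, ∃ x y : S, a = m (m x (m a a)) y) ↔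
    (∀ A : Set S, A.Nonempty → Set.image2 m A Set.univ ⊆ A →
        ∀ a : S, m a a ∈ A → a ∈ A) := by
  have med : ∀ a b c d, m (m a b) (m c d) = m (m a c) (m b d) := by
    intro a b c d
    rw [hinv a b, hinv c d b, hinv (m b d) c a]
  have para : ∀ a b c d, m (m a b) (m c d) = m (m d c) (m b a) := by
    intro a b c d
    calc m (m a b) (m c d) = m (m e (m a b)) (m c d) := by rw [he]
      _ = m (m (m c d) (m a b)) e := hinv _ _ _
      _ = m (m (m c a) (m d b)) e := by rw [med c d a b]
      _ = m (m e (m d b)) (m c a) := hinv _ _ _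
      _ = m (m d b) (m c a) := by rw [he]
      _ = m (m d c) (m b a) := med _ _ _ _
  constructor
  · intro h A _ hA a ha
    have hr : ∀ x ∈ A, ∀ s, m x s ∈ A := fun x hx s =>
      hA (Set.mem_image2_of_mem hx (Set.mem_univ s))
    obtain ⟨x, y, hxy⟩ := h a
    have h1 : m x (m a a) = m (m (m a a) x) e := by
      rw [hinv (m a a) x e, he]
    rw [hxy, h1]
    exact hr _ (hr _ (hr _ ha _) _) _
  · intro h a
    have h2 : m (m a a) e = m a a := by rw [hinv a a e, he]
    obtain ⟨s, hs⟩ := h {z | ∃ s, z = m (m a a) s} ⟨_, e, rfl⟩ (by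
      rintro _ ⟨_, ⟨s, rfl⟩, t, _, rfl⟩
      exact ⟨m s t, by rw [hinv (m a a) s t, para t s a a]⟩) a ⟨e, h2.symm⟩
    exact ⟨e, s, by rw [he]; exact hs⟩
end

section
/- A unitary AG-groupoid S is intra-regular if and only if all its interior ideals are semiprime. -/
/-- A unitary AG-groupoid `S` is intra-regular if and only if all its interior
ideals (nonempty `A` with `AA ⊆ A` and `(SA)S ⊆ A`) are semiprime. -/
theorem intra_regular_iff_interior_ideals_semiprime {S : Type*} (m : S → S → S)
    (hinv : ∀ a b c : S, m (m a b) c = m (m c b) a)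
    (e : S) (he : ∀ a : S, m e a = a) :
    (∀ a : S, ∃ x y : S, a = m (m x (m a a)) y) ↔
    (∀ A : Set S, A.Nonempty → Set.image2 m A A ⊆ A →
        Set.image2 m (Set.image2 m Set.univ A) Set.univ ⊆ A →
        ∀ a : S, m a a ∈ A → a ∈ A) := by
  have med : ∀ a b c d : S, m (m a b) (m c d) = m (m a c) (m b d) := by
    intro a b c d
    rw [hinv a b (m c d), hinv c d b, hinv (m b d) c a]
  have lc : ∀ a b c : S, m a (m b c) = m b (m a c) := by
    intro a b c
    have h := med e a b c
    rwa [he, he] at h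
  have sw : ∀ a b : S, m a b = m (m b a) e := by
    intro a b
    rw [hinv b a e, he]
  have par : ∀ a b c d : S, m (m a b) (m c d) = m (m d c) (m b a) := by
    intro a b c d
    rw [sw (m a b) (m c d), hinv (m c d) (m a b) e, he, sw a b, sw c d, med (m b a) e (m d c) e,
      he, hinv (m b a) (m d c) e, he]
  have zr : ∀ z a : S, m z (m a a) = m (m a a) (m z e) := by
    intro z a
    have h := par e z a a
    rwa [he] at h
  constructor
  · intro h A _ _ hA a ha
    obtain ⟨x, y, hxy⟩ := h a
    rw [hxy]
    exact hA ⟨_, ⟨x, trivial, _, ha, rfl⟩, y, trivial, rfl⟩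
  · intro h a
    have key : a ∈ {z : S | ∃ x, z = m (m a a) x} := by
      apply h
      · exact ⟨_, e, rfl⟩
      · rintro _ ⟨_, ⟨x, rfl⟩, _, ⟨y, rfl⟩, rfl⟩
        exact ⟨_, lc _ _ _⟩
      · rintro _ ⟨_, ⟨s, -, _, ⟨x, rfl⟩, rfl⟩, t, -, rfl⟩
        refine ⟨m (m t (m s x)) e, ?_⟩
        change m (m s (m (m a a) x)) t = _
        rw [lc s (m a a) x, hinv (m a a) (m s x) t, zr]
      · exact ⟨e, by rw [hinv a a e, he]⟩
    obtain ⟨w, hw⟩ := key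
    exact ⟨e, w, by rw [he]; exact hw⟩
end

section
/- A unitary AG-groupoid S is intra-regular if and only if A ∩ B ∩ C ⊆ (AB)C holds for all nonempty subsets A, B, C of S of which at least one is a left ideal of S. -/
/-- A unitary AG-groupoid `S` is intra-regular if and only if
`A ∩ B ∩ C ⊆ (AB)C` for all nonempty subsets `A, B, C` of `S` of which at
least one is a left ideal of `S`. -/
theorem intra_regular_iff_left_ideal_triple {S : Type*} (m : S → S → S)
    (hinv : ∀ a b c : S, m (m a b) c = m (m c b) a)
    (e : S) (he : ∀ a : S, m e a = a) :
    (∀ a : S, ∃ x y : S, a = m (m x (m a a)) y) ↔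
    (∀ A B C : Set S, A.Nonempty → B.Nonempty → C.Nonempty →
        (Set.image2 m Set.univ A ⊆ A ∨ Set.image2 m Set.univ B ⊆ B ∨
          Set.image2 m Set.univ C ⊆ C) →
        A ∩ B ∩ C ⊆ Set.image2 m (Set.image2 m A B) C) := by
  have med : ∀ a b c d, m (m a b) (m c d) = m (m a c) (m b d) := by
    intro a b c d
    rw [hinv a b (m c d), hinv c d b, hinv (m b d) c a]
  have lc : ∀ a b c, m a (m b c) = m b (m a c) := by
    intro a b c
    have h := med e a b c
    rwa [he, he] at h
  have par : ∀ a b c d, m (m a b) (m c d) = m (m d c) (m b a) := by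
    intro a b c d
    rw [hinv a b (m c d), lc (m d c) b a, hinv (m c d) b a,
      lc (m a b) c d, hinv a b d, lc c (m d b) a, hinv d b (m c a),
      hinv c a b, lc b (m d c) a, hinv (m b a) c d]
  constructor
  · intro h A B C _ _ _ hl a ha
    obtain ⟨⟨hA, hB⟩, hC⟩ := ha
    obtain ⟨x, y, hxy⟩ := h a
    obtain ⟨z, hz⟩ : ∃ z, a = m (m a a) z := by
      refine ⟨m (m y e) x, ?_⟩
      have h1 := par x (m a a) e y
      rw [he, lc (m y e)] at h1
      exact hxy.trans h1
    have hz2 : a = m (m z a) a := hz.trans (hinv a a z)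
    have h2 : m a a = m (m z a) (m a a) := by
      have h3 := lc a (m z a) a
      rwa [← hz2] at h3
    have hc : a = m (m a a) (m (m z z) a) := by
      calc a = m (m a a) z := hz
        _ = m (m (m z a) (m a a)) z := by rw [← h2]
        _ = m (m z (m a a)) (m z a) := hinv _ _ _
        _ = m (m z z) (m (m a a) a) := med _ _ _ _
        _ = _ := lc _ _ _
    have ha' : a = m (m (m (m z z) a) a) a := hc.trans (hinv _ _ _)
    have hb : a = m (m a (m (m (m z z) e) a)) a := by
      have h4 := par a a e (m z z)
      rw [he] at h4
      rw [lc a, ← h4, ← hinv (m z z) a a]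
      exact ha'
    rcases hl with hl | hl | hl
    · exact ⟨_, ⟨_, hl ⟨m z z, trivial, a, hA, rfl⟩, a, hB, rfl⟩, a, hC, ha'.symm⟩
    · exact ⟨_, ⟨a, hA, _, hl ⟨m (m z z) e, trivial, a, hB, rfl⟩, rfl⟩, a, hC, hb.symm⟩
    · exact ⟨_, ⟨a, hA, a, hB, rfl⟩, _, hl ⟨m z z, trivial, a, hC, rfl⟩, hc.symm⟩
  · intro h a
    obtain ⟨_, ⟨b, hb, c, hc, rfl⟩, y, _, hy⟩ := h {a} {a} Set.univ ⟨a, rfl⟩ ⟨a, rfl⟩ ⟨a, trivial⟩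
      (Or.inr (Or.inr (Set.subset_univ _))) ⟨⟨rfl, rfl⟩, trivial⟩
    have hb' : b = a := hb
    have hc' : c = a := hc
    subst hb'
    rw [hc'] at hy
    exact ⟨e, y, by rw [he]; exact hy.symm⟩
end

section
/- A unitary AG-groupoid S is intra-regular if and only if A ∩ B ⊆ AB ∩ BA holds for all left ideals A, B of S. -/
/-- A unitary AG-groupoid `S` is intra-regular if and only if
`A ∩ B ⊆ AB ∩ BA` for all left ideals `A, B` of `S`. -/
theorem intra_regular_iff_left_ideal_pair {S : Type*} (m : S → S → S)
    (hinv : ∀ a b c : S, m (m a b) c = m (m c b) a)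
    (e : S) (he : ∀ a : S, m e a = a) :
    (∀ a : S, ∃ x y : S, a = m (m x (m a a)) y) ↔
    (∀ A B : Set S, A.Nonempty → B.Nonempty →
        Set.image2 m Set.univ A ⊆ A → Set.image2 m Set.univ B ⊆ B →
        A ∩ B ⊆ Set.image2 m A B ∩ Set.image2 m B A) := by
  have med : ∀ a b c d, m (m a b) (m c d) = m (m a c) (m b d) := fun a b c d => by
    rw [hinv a b, hinv c d b, hinv (m b d) c a]
  have lft : ∀ a b c, m a (m b c) = m b (m a c) := fun a b c => by
    have h := med e a b c
    rwa [he, he] at h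
  have par : ∀ a b c d, m (m a b) (m c d) = m (m d c) (m b a) := fun a b c d => by
    rw [lft (m a b) c d, hinv a b d, lft c (m d b) a, med d b c a]
  constructor
  · intro h A B _ _ hA hB a ha
    obtain ⟨x, y, hxy⟩ := h a
    have key : m (m y (m x a)) a = a := by
      rw [lft x a a, hinv a (m x a) y] at hxy
      exact hxy.symm
    have cl : ∀ C : Set S, Set.image2 m Set.univ C ⊆ C → a ∈ C → m y (m x a) ∈ C :=
      fun C hC haC => hC ⟨y, trivial, m x a, hC ⟨x, trivial, a, haC, rfl⟩, rfl⟩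
    exact ⟨⟨_, cl A hA ha.1, a, ha.2, key⟩, ⟨_, cl B hB ha.2, a, ha.1, key⟩⟩
  · intro h a
    have hL : Set.image2 m Set.univ {z | ∃ s, z = m s a} ⊆ {z | ∃ s, z = m s a} := by
      rintro _ ⟨t, _, _, ⟨s, rfl⟩, rfl⟩
      refine ⟨m (m t e) s, ?_⟩
      have h1 := par e t s a
      rw [he] at h1
      rw [h1, hinv a s]
    have haL : a ∈ {z | ∃ s, z = m s a} := ⟨e, (he a).symm⟩
    obtain ⟨_, ⟨u, rfl⟩, _, ⟨v, rfl⟩, huv⟩ := (h _ _ ⟨a, haL⟩ ⟨a, haL⟩ hL hL ⟨haL, haL⟩).1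
    refine ⟨e, m (m u v) e, ?_⟩
    have h2 := par e (m u v) a a
    rw [he] at h2
    rw [he, ← h2, ← med u a v a, huv]
end

section
/- A unitary AG-groupoid S is intra-regular if and only if A ∩ B ∩ C ⊆ (AB)C holds for every generalized bi-ideal A of S and all nonempty subsets B, C of S. -/
theorem aux_comm_s15 {M : Type*} [CommMonoid M] (φ : M → M) (h2 : ∀ a, φ (φ a) = a)
    (hmul : ∀ a b, φ (a * b) = φ a * φ b) (a x y : M)
    (h : a = φ (φ x * (φ a * a)) * y) :
    ∃ t, φ (φ (φ (φ a * t) * a) * a) * a = a := by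
  simp only [hmul, h2] at h ⊢
  have h1 : φ a = φ x * (φ a * a) * φ y := by
    conv_lhs => rw [h]
    simp only [hmul, h2]

  refine ⟨φ (x * y) * (x * y) * (x * y), ?_⟩
  simp only [hmul, h2]
  generalize φ a = b at *
  generalize φ x = x' at *
  generalize φ y = y' at *
  calc _ = a * (x * y) * (x' * ((x' * (b * a) * y') * a) * y') := by
        ac_rfl
    _ = a * (x * y) * (x' * (b * a) * y') := by rw [← h1, ← h1]
    _ = a * (x * y) * b := congrArg _ h1.symm
    _ = x * (b * a) * y := by ac_rfl
    _ = a := by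
        rw [mul_comm b a] at *
        exact h.symm

/-- A unitary AG-groupoid `S` is intra-regular if and only if
`A ∩ B ∩ C ⊆ (AB)C` for every generalized bi-ideal `A` of `S` (nonempty `A`
with `(AS)A ⊆ A`) and all nonempty subsets `B, C` of `S`. -/
theorem intra_regular_iff_gen_bi_ideal_triple {S : Type*} (m : S → S → S)
    (hinv : ∀ a b c : S, m (m a b) c = m (m c b) a)
    (e : S) (he : ∀ a : S, m e a = a) :
    (∀ a : S, ∃ x y : S, a = m (m x (m a a)) y) ↔
    (∀ A B C : Set S, A.Nonempty → B.Nonempty → C.Nonempty →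
        Set.image2 m (Set.image2 m A Set.univ) A ⊆ A →
        A ∩ B ∩ C ⊆ Set.image2 m (Set.image2 m A B) C) := by
  constructor
  · intro H A B C _ _ _ hA a ha
    obtain ⟨⟨haA, haB⟩, haC⟩ := ha
    have hl : ∀ a b c : S, m a (m b c) = m b (m a c) := by
      intro a b c
      have h1 : ∀ a b c d, m (m a b) (m c d) = m (m a c) (m b d) := by
        intro a b c d
        rw [hinv a b, hinv c d b, hinv (m b d) c a]
      calc m a (m b c) = m (m e a) (m b c) := by rw [he]
        _ = m (m e b) (m a c) := h1 _ _ _ _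
        _ = m b (m a c) := by rw [he]
    have key : ∃ t, m (m (m (m a t) a) a) a = a := by
      obtain ⟨x, y, hxy⟩ := H a
      have hc : ∀ a b, m (m a e) b = m (m b e) a := fun a b => hinv _ _ _
      let _ : CommMonoid S :=
        { mul := fun a b => m (m a e) b
          one := e
          mul_assoc := by
            intro a b c
            change m (m (m (m a e) b) e) c = m (m a e) (m (m b e) c)
            rw [hc, hl, hc c b]
          one_mul := by
            intro a
            change m (m e e) a = a
            rw [he, he]
          mul_one := by
            intro a
            change m (m a e) e = a
            rw [hinv, he, he]
          mul_comm := hc }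
      have h2 : ∀ a, m (m a e) e = a := by
        intro a
        rw [hinv, he, he]
      have hm : ∀ a b, m a b = m a e * b := by
        intro a b
        change m a b = m (m (m a e) e) b
        rw [h2]
      have hmul : ∀ a b : S, m (a * b) e = m a e * m b e := by
        intro a b
        change m (m (m a e) b) e = m (m (m a e) e) (m b e)
        rw [h2, hinv, he, hl]
      have := aux_comm_s15 (fun a => m a e) h2 hmul a x y (by
        rw [hm a a, hm x, hm _ y] at hxy
        exact hxy)
      obtain ⟨t, ht⟩ := this
      refine ⟨t, ?_⟩
      rw [hm a t, hm _ a, hm _ a, hm _ a]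
      exact ht
    obtain ⟨t, ht⟩ := key
    exact ⟨_, ⟨_, hA ⟨_, ⟨a, haA, t, trivial, rfl⟩, a, haA, rfl⟩, a, haB, rfl⟩, a, haC, ht⟩
  · intro H a
    obtain ⟨_, ⟨u, _, b, hb, rfl⟩, c, hc, h⟩ := H Set.univ {a} {a} ⟨a, trivial⟩ ⟨a, rfl⟩ ⟨a, rfl⟩
      (Set.subset_univ _) (show a ∈ _ from ⟨⟨trivial, rfl⟩, rfl⟩)
    obtain rfl : b = a := hb
    obtain rfl : c = b := hc
    refine ⟨e, u, ?_⟩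
    rw [he, ← hinv]
    exact h.symm
end

section
/- A unitary AG-groupoid S is intra-regular if and only if A ∩ B ⊆ AB ∩ BA holds for every bi-ideal A of S and every nonempty subset B of S. -/
/-- A unitary AG-groupoid `S` is intra-regular if and only if
`A ∩ B ⊆ AB ∩ BA` for every bi-ideal `A` of `S` (nonempty `A` with `AA ⊆ A`
and `(AS)A ⊆ A`) and every nonempty subset `B` of `S`. -/
theorem intra_regular_iff_bi_ideal_pair {S : Type*} (m : S → S → S)
    (hinv : ∀ a b c : S, m (m a b) c = m (m c b) a)
    (e : S) (he : ∀ a : S, m e a = a) :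
    (∀ a : S, ∃ x y : S, a = m (m x (m a a)) y) ↔
    (∀ A B : Set S, A.Nonempty → B.Nonempty →
        Set.image2 m A A ⊆ A →
        Set.image2 m (Set.image2 m A Set.univ) A ⊆ A →
        A ∩ B ⊆ Set.image2 m A B ∩ Set.image2 m B A) := by
  have med : ∀ a b c d : S, m (m a b) (m c d) = m (m a c) (m b d) := by
    intro a b c d
    rw [hinv a b (m c d), hinv c d b, hinv (m b d) c a]
  have lc : ∀ a b c : S, m a (m b c) = m b (m a c) := by
    intro a b c
    have h := med e a b c
    rwa [he, he] at h
  have para : ∀ a b c d : S, m (m a b) (m c d) = m (m d b) (m c a) := by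
    intro a b c d
    rw [lc (m a b) c d, hinv a b d, lc c (m d b) a]
  have idl : ∀ s t a : S, m s (m t a) = m (m (m s e) t) a := by
    intro s t a
    have h := para e s t a
    rw [he] at h
    rw [h, med a s t e, hinv a t (m s e)]
  constructor
  · intro h A B _ _ _ hA2 a ⟨haA, haB⟩
    obtain ⟨x, y, hxy⟩ := h a
    -- a = u (a a) for some u
    have h1 : a = m (m y (m x a)) a := by
      rw [lc x a a, hinv] at hxy
      exact hxy
    rw [idl y x a] at h1
    generalize m (m y e) x = t at h1
    have hsq : ∀ s, ∃ r, m (m s a) a = m r (m a a) := by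
      intro s
      refine ⟨m s e, ?_⟩
      have := para a a e s
      rw [he] at this
      rw [hinv s a a, this, med]
    obtain ⟨t', ht'⟩ := hsq t
    have h2 : a = m t' (m a a) := h1.trans ht'
    have sub1 : ∀ s, ∃ r, m s a = m a r := by
      intro s
      refine ⟨m s (m t' a), ?_⟩
      conv_lhs => rw [h2]
      rw [lc t' a a, lc s a]
    have sub2 : ∀ s, m s a ∈ A := by
      intro s
      have h3 : m s a = m (m (m (m t s) e) a) a := by
        have h4 : m s a = m (m t a) (m s a) := by
          rw [lc (m t a) s a, ← h1]
        have h5 : m (m t a) (m s a) = m (m t s) (m a a) := med _ _ _ _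
        exact (h4.trans h5).trans (idl _ _ _)
      obtain ⟨r, hr⟩ := sub1 (m (m t s) e)
      rw [h3, hr]
      exact hA2 ⟨_, ⟨a, haA, r, trivial, rfl⟩, a, haA, rfl⟩
    refine ⟨⟨m t a, sub2 t, a, haB, h1.symm⟩, ⟨a, haB, m t' a, sub2 t', ?_⟩⟩
    rw [lc a t' a]
    exact h2.symm
  · intro h a
    have hs := @h {z | ∃ s, z = m s a} {a} ⟨a, e, (he a).symm⟩ ⟨a, rfl⟩ ?_ ?_ a
      ⟨⟨e, (he a).symm⟩, rfl⟩
    · obtain ⟨⟨_, ⟨s, rfl⟩, _, rfl, hh⟩, _⟩ := hs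
      refine ⟨e, s, ?_⟩
      rw [he, hinv, hh]
    · rintro _ ⟨_, ⟨s, rfl⟩, _, ⟨t, rfl⟩, rfl⟩
      exact ⟨_, idl _ _ _⟩
    · rintro _ ⟨_, _, _, ⟨t, rfl⟩, rfl⟩
      exact ⟨_, idl _ _ _⟩
end

section
/- A unitary AG-groupoid S is intra-regular if and only if A = AA holds for every left ideal A of S; equivalently, S is intra-regular if and only if A = (AA)A holds for every left ideal A of S. -/
/-- A unitary AG-groupoid `S` is intra-regular if and only if `A = AA` for
every left ideal `A` of `S`; equivalently, `S` is intra-regular if and only if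
`A = (AA)A` for every left ideal `A` of `S`. -/
theorem intra_regular_iff_left_ideal_idempotent {S : Type*} (m : S → S → S)
    (hinv : ∀ a b c : S, m (m a b) c = m (m c b) a)
    (e : S) (he : ∀ a : S, m e a = a) :
    ((∀ a : S, ∃ x y : S, a = m (m x (m a a)) y) ↔
      (∀ A : Set S, A.Nonempty → Set.image2 m Set.univ A ⊆ A →
        A = Set.image2 m A A)) ∧
    ((∀ a : S, ∃ x y : S, a = m (m x (m a a)) y) ↔
      (∀ A : Set S, A.Nonempty → Set.image2 m Set.univ A ⊆ A →
        A = Set.image2 m (Set.image2 m A A) A)) := by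
  have med : ∀ a b c d, m (m a b) (m c d) = m (m a c) (m b d) := fun a b c d => by
    rw [hinv a b (m c d), hinv c d b, hinv (m b d) c a]
  have lc : ∀ a b c, m a (m b c) = m b (m a c) := fun a b c => by
    have h := med e a b c
    rwa [he, he] at h
  have as : ∀ x y a, m x (m y a) = m (m (m x e) y) a := fun x y a => by
    rw [hinv (m x e) y a, lc (m a y) x e, hinv a y e, he]
  have fwd : (∀ a : S, ∃ x y : S, a = m (m x (m a a)) y) →
      (∀ A : Set S, A.Nonempty → Set.image2 m Set.univ A ⊆ A →
        A = Set.image2 m A A) := by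
    intro h A _ hA
    have hA' : ∀ s a, a ∈ A → m s a ∈ A := fun s a ha => hA ⟨s, trivial, a, ha, rfl⟩
    apply Set.Subset.antisymm
    · intro a ha
      obtain ⟨x, y, hxy⟩ := h a
      refine ⟨m y (m x a), hA' _ _ (hA' _ _ ha), a, ha, ?_⟩
      rw [lc x a a, hinv a (m x a) y] at hxy
      exact hxy.symm
    · rintro _ ⟨a, _, b, hb, rfl⟩
      exact hA' _ _ hb
  have bwd : (∀ A : Set S, A.Nonempty → Set.image2 m Set.univ A ⊆ A →
        A = Set.image2 m A A) → (∀ a : S, ∃ x y : S, a = m (m x (m a a)) y) := by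
    intro h a
    have hm : a ∈ Set.range (fun x => m x a) := ⟨e, he a⟩
    have hI := h (Set.range (fun x => m x a)) ⟨a, hm⟩ (by
      rintro _ ⟨x, _, _, ⟨y, rfl⟩, rfl⟩
      exact ⟨m (m x e) y, (as x y a).symm⟩)
    rw [hI] at hm
    obtain ⟨_, ⟨x, rfl⟩, _, ⟨y, rfl⟩, hxy⟩ := hm
    have h1 : a = m (m x y) (m a a) := by
      rw [← med]; exact hxy.symm
    generalize m x y = z at h1
    have h2 : m a a = m (m a a) (m (m z z) (m a a)) := by
      rw [lc (m a a), ← med z (m a a) z (m a a), ← h1]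
    refine ⟨e, m z (m (m z z) (m a a)), ?_⟩
    rw [he, lc (m a a) z, ← h2]
    exact h1
  refine ⟨⟨fwd, bwd⟩, fun h A hne hA => ?_, fun h => bwd fun A hne hA => ?_⟩
  · have h1 := fwd h A hne hA
    rw [← h1]
    exact h1
  · have h1 := h A hne hA
    have h2 : Set.image2 m A A ⊆ A := (Set.image2_subset_right (Set.subset_univ A)).trans hA
    apply Set.Subset.antisymm
    · exact h1.subset.trans (Set.image2_subset_right h2)
    · exact h2
end

section
/- In a unitary AG-groupoid S, for every a in S the subsets Sa ∩ aS, Sa, and Sa² are quasi-ideals of S; moreover (Sa)(Sa) = Sa² = (Sa²)S. -/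
/-- In a unitary AG-groupoid `S`, for every `a` the subsets `Sa ∩ aS`, `Sa`
and `Sa²` are quasi-ideals (nonempty `Q` with `SQ ∩ QS ⊆ Q`); moreover
`(Sa)(Sa) = Sa² = (Sa²)S`. -/
theorem quasi_ideals_Sa {S : Type*} (m : S → S → S)
    (hinv : ∀ a b c : S, m (m a b) c = m (m c b) a)
    (e : S) (he : ∀ a : S, m e a = a) :
    ∀ a : S,
      ((Set.range (fun s => m s a) ∩ Set.range (fun s => m a s)).Nonempty ∧
        Set.image2 m Set.univ (Set.range (fun s => m s a) ∩ Set.range (fun s => m a s)) ∩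
          Set.image2 m (Set.range (fun s => m s a) ∩ Set.range (fun s => m a s)) Set.univ ⊆
          Set.range (fun s => m s a) ∩ Set.range (fun s => m a s)) ∧
      ((Set.range (fun s => m s a)).Nonempty ∧
        Set.image2 m Set.univ (Set.range (fun s => m s a)) ∩
          Set.image2 m (Set.range (fun s => m s a)) Set.univ ⊆
          Set.range (fun s => m s a)) ∧
      ((Set.range (fun s => m s (m a a))).Nonempty ∧
        Set.image2 m Set.univ (Set.range (fun s => m s (m a a))) ∩
          Set.image2 m (Set.range (fun s => m s (m a a))) Set.univ ⊆
          Set.range (fun s => m s (m a a))) ∧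
      (Set.image2 m (Set.range (fun s => m s a)) (Set.range (fun s => m s a)) =
        Set.range (fun s => m s (m a a)) ∧
       Set.range (fun s => m s (m a a)) =
        Set.image2 m (Set.range (fun s => m s (m a a))) Set.univ) := by
  have med : ∀ a b c d, m (m a b) (m c d) = m (m a c) (m b d) := by
    intro a b c d
    rw [hinv a b, hinv c d b, hinv (m b d) c a]
  have lp : ∀ a b c, m a (m b c) = m b (m a c) := by
    intro a b c
    have h := med e a b c
    rwa [he, he] at h
  have para : ∀ a b c d, m (m a b) (m c d) = m (m d c) (m b a) := by
    intro a b c d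
    rw [lp (m a b) c d, hinv a b d, lp c (m d b) a, med]
  have hL : ∀ s t a, m s (m t a) = m (m (m s e) t) a := by
    intro s t a
    have h := para e s t a
    rw [he] at h
    rw [h, hinv]
  have hR : ∀ s t a, m (m s (m a a)) t = m (m (m (m t e) s) e) (m a a) := by
    intro s t a
    have h := para s (m a a) e t
    rw [he] at h
    rw [h, lp (m t e)]
    have h2 := para a a e (m (m t e) s)
    rw [he] at h2
    exact h2
  intro a
  refine ⟨⟨⟨m a a, ⟨a, rfl⟩, ⟨a, rfl⟩⟩, ?_⟩, ⟨⟨m a a, a, rfl⟩, ?_⟩,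
    ⟨⟨m a (m a a), a, rfl⟩, ?_⟩, ?_, ?_⟩
  · rintro _ ⟨⟨s, -, q, ⟨⟨t, rfl⟩, ⟨u, hu⟩⟩, rfl⟩, -⟩
    refine ⟨⟨_, (hL s t a).symm⟩, ⟨m s u, ?_⟩⟩
    change m a u = m t a at hu
    change m a (m s u) = m s (m t a)
    rw [← hu, lp]
  · rintro _ ⟨⟨s, -, q, ⟨t, rfl⟩, rfl⟩, -⟩
    exact ⟨_, (hL s t a).symm⟩
  · rintro _ ⟨⟨s, -, q, ⟨t, rfl⟩, rfl⟩, -⟩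
    exact ⟨_, (hL s t (m a a)).symm⟩
  · ext x
    constructor
    · rintro ⟨_, ⟨s, rfl⟩, _, ⟨t, rfl⟩, rfl⟩
      exact ⟨m s t, med s t a a⟩
    · rintro ⟨s, rfl⟩
      refine ⟨_, ⟨e, rfl⟩, _, ⟨s, rfl⟩, ?_⟩
      change m (m e a) (m s a) = m s (m a a)
      rw [med, he]
  · ext x
    constructor
    · rintro ⟨s, rfl⟩
      refine ⟨_, ⟨e, rfl⟩, m s e, trivial, ?_⟩
      change m (m e (m a a)) (m s e) = m s (m a a)
      rw [he, para, he]
    · rintro ⟨_, ⟨s, rfl⟩, t, -, rfl⟩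
      exact ⟨_, (hR s t a).symm⟩
end

section
/- For a unitary AG-groupoid S the following are equivalent: (i) S is intra-regular; (ii) Sa ⊆ Sa² for every a in S; (iii) I ∩ J ⊆ IJ for all quasi-ideals I, J of S. -/
/-- For a unitary AG-groupoid `S` the following are equivalent:
(i) `S` is intra-regular; (ii) `Sa ⊆ Sa²` for every `a`;
(iii) `I ∩ J ⊆ IJ` for all quasi-ideals `I, J` of `S`. -/
theorem intra_regular_tfae_quasi {S : Type*} (m : S → S → S)
    (hinv : ∀ a b c : S, m (m a b) c = m (m c b) a)
    (e : S) (he : ∀ a : S, m e a = a) :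
    ((∀ a : S, ∃ x y : S, a = m (m x (m a a)) y) ↔
      (∀ a : S, Set.range (fun s => m s a) ⊆ Set.range (fun s => m s (m a a)))) ∧
    ((∀ a : S, ∃ x y : S, a = m (m x (m a a)) y) ↔
      (∀ I J : Set S, I.Nonempty → J.Nonempty →
        Set.image2 m Set.univ I ∩ Set.image2 m I Set.univ ⊆ I →
        Set.image2 m Set.univ J ∩ Set.image2 m J Set.univ ⊆ J →
        I ∩ J ⊆ Set.image2 m I J)) := by
  have med : ∀ a b c d, m (m a b) (m c d) = m (m a c) (m b d) := by
    intro a b c d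
    rw [hinv a b (m c d), hinv c d b, hinv (m b d) c a]
  have lc : ∀ a b c, m a (m b c) = m b (m a c) := by
    intro a b c
    have h := med e a b c
    rw [he, he] at h
    exact h
  have par : ∀ a b c d, m (m a b) (m c d) = m (m d c) (m b a) := by
    intro a b c d
    rw [lc (m a b) c d, hinv a b d, lc c (m d b) a, med d b c a]
  have sq : ∀ a z, m (m a a) z = m (m z e) (m a a) := by
    intro a z
    have h := par a a e z
    rw [he] at h
    exact h
  have sq' : ∀ a t, m t (m a a) = m (m a a) (m t e) := by
    intro a t
    have h := par e t a a
    rw [he] at h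
    exact h
  have key : ∀ a p q, ∃ t, m (m p (m a a)) q = m t (m a a) := by
    intro a p q
    refine ⟨m (m (m q e) p) e, ?_⟩
    have h := par p (m a a) e q
    rw [he] at h
    rw [h, lc, sq]
  have i_iff : (∀ a : S, ∃ x y : S, a = m (m x (m a a)) y) ↔ ∀ a, ∃ t, a = m t (m a a) := by
    constructor
    · intro h a
      obtain ⟨x, y, hxy⟩ := h a
      obtain ⟨t, ht⟩ := key a x y
      exact ⟨t, hxy.trans ht⟩
    · intro h a
      obtain ⟨t, ht⟩ := h a
      refine ⟨e, m t e, ?_⟩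
      rw [he, ← sq']
      exact ht
  have ii : (∀ a, ∃ t, a = m t (m a a)) → ∀ a s, ∃ t, m s a = m t (m a a) := by
    intro h a s
    obtain ⟨t, ht⟩ := h a
    refine ⟨m (m s (m t e)) e, ?_⟩
    rw [← sq, ← lc, ← sq', ← ht]
  rw [i_iff]
  refine ⟨⟨?_, ?_⟩, ⟨?_, ?_⟩⟩
  · rintro h a _ ⟨s, rfl⟩
    obtain ⟨t, ht⟩ := ii h a s
    exact ⟨t, ht.symm⟩
  · intro h a
    obtain ⟨t, ht⟩ := h a ⟨e, he a⟩
    exact ⟨t, ht.symm⟩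
  · rintro h I J - - - hJ a ⟨haI, haJ⟩
    obtain ⟨t, ht⟩ := h a
    obtain ⟨u, hu⟩ := ii h a t
    refine ⟨a, haI, m t a, hJ ⟨⟨t, trivial, a, haJ, rfl⟩, ⟨a, haJ, m u a, trivial, ?_⟩⟩, ?_⟩
    · show m a (m u a) = m t a
      rw [lc, ← hu]
    · show m a (m t a) = a
      rw [lc, ← ht]
  · intro h a
    have hq : Set.image2 m Set.univ (Set.range fun s => m s a) ∩
        Set.image2 m (Set.range fun s => m s a) Set.univ ⊆ Set.range fun s => m s a := by
      rintro _ ⟨⟨s, -, _, ⟨t, rfl⟩, rfl⟩, -⟩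
      refine ⟨m (m s e) t, ?_⟩
      have h2 := par e s t a
      rw [he] at h2
      show m (m (m s e) t) a = m s (m t a)
      rw [h2, hinv]
    have ha : a ∈ Set.range fun s => m s a := ⟨e, he a⟩
    obtain ⟨_, ⟨s, rfl⟩, _, ⟨t, rfl⟩, hst⟩ := h _ _ ⟨a, ha⟩ ⟨a, ha⟩ hq hq ⟨ha, ha⟩
    refine ⟨m s t, ?_⟩
    rw [← med]
    exact hst.symm
end
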